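/- Let N ≥ 5. Then for every u ∈ C_c^∞(ℍ^N∖{o}) one has ∫_{ℍ^N} (Δ_r u)² dv − ((N−1)/2)² ∫_{ℍ^N} |∇_r u|² dv ≥ ((N−4)²/16) ∫_{ℍ^N} u²/r⁴ dv + ((N−1)/16) ∫_{ℍ^N} u²/r² dv. -/

import Mathlib

open MeasureTheory Real Set

noncomputable section

/-- The radial derivative `∇_r u = ∂u/∂r` of a function `u(r,σ)`. -/
def radGrad (N : ℕ) (u : ℝ → EuclideanSpace ℝ (Fin N) → ℝ) :
    ℝ → EuclideanSpace ℝ (Fin N) → ℝ :=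
  fun r σ => deriv (fun s => u s σ) r

/-- The radial Laplacian `Δ_r u = ∂²u/∂r² + (N-1) coth r · ∂u/∂r`. -/
def radLap (N : ℕ) (u : ℝ → EuclideanSpace ℝ (Fin N) → ℝ) :
    ℝ → EuclideanSpace ℝ (Fin N) → ℝ :=
  fun r σ => deriv (fun s => deriv (fun t => u t σ) s) r
    + ((N : ℝ) - 1) * (Real.cosh r / Real.sinh r) * deriv (fun s => u s σ) r

/-- The higher order radial derivative `∇_r^k u`: `Δ_r^{k/2} u` for even `k`,
`∂_r (Δ_r^{(k-1)/2} u)` for odd `k`. -/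
def radPow (N k : ℕ) (u : ℝ → EuclideanSpace ℝ (Fin N) → ℝ) :
    ℝ → EuclideanSpace ℝ (Fin N) → ℝ :=
  if Even k then (radLap N)^[k / 2] u else radGrad N ((radLap N)^[k / 2] u)

/-- The integral over the hyperbolic space `ℍ^N` in polar coordinates:
`∫_{S^{N-1}} ∫_0^∞ F(r,σ) (sinh r)^{N-1} dr dσ`, where `dσ` is the standard
surface measure (the `(N-1)`-dimensional Hausdorff measure) on the unit sphere. -/
def hypInt (N : ℕ) (F : ℝ → EuclideanSpace ℝ (Fin N) → ℝ) : ℝ :=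
  ∫ σ in Metric.sphere (0 : EuclideanSpace ℝ (Fin N)) 1,
    (∫ r in Ioi (0 : ℝ), F r σ * Real.sinh r ^ (N - 1)) ∂μH[(N : ℝ) - 1]

/-- `u ∈ C_c^∞(ℍ^N)`: `u(r,σ)` smooth (including at the pole `r = 0`) and
vanishing for all `r` larger than some `R`. -/
def IsCc (N : ℕ) (u : ℝ → EuclideanSpace ℝ (Fin N) → ℝ) : Prop :=
  ContDiff ℝ (⊤ : ℕ∞) (Function.uncurry u) ∧
  ∃ R : ℝ, ∀ r : ℝ, R < r → ∀ σ ∈ Metric.sphere (0 : EuclideanSpace ℝ (Fin N)) 1, u r σ = 0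

/-- `u ∈ C_c^∞(ℍ^N \ {o})`: `u(r,σ)` smooth with support contained in
`[a,b] × S^{N-1}` for some `0 < a ≤ b`. -/
def IsCcAway (N : ℕ) (u : ℝ → EuclideanSpace ℝ (Fin N) → ℝ) : Prop :=
  ContDiff ℝ (⊤ : ℕ∞) (Function.uncurry u) ∧
  ∃ a b : ℝ, 0 < a ∧ a ≤ b ∧
    ∀ r : ℝ, r ∉ Icc a b → ∀ σ ∈ Metric.sphere (0 : EuclideanSpace ℝ (Fin N)) 1, u r σ = 0

lemma hausdorffMeasure_image_lt_top {F E : Type*} [NormedAddCommGroup F] [NormedSpace ℝ F]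
    [FiniteDimensional ℝ F] [NormedAddCommGroup E] [NormedSpace ℝ E] [MeasurableSpace E]
    [BorelSpace E] {f : F → E} (hf : ContDiff ℝ 1 f) {K : Set F} (hK : IsCompact K) :
    μH[(Module.finrank ℝ F : ℝ)] (f '' K) < ⊤ := by
  let e : F ≃L[ℝ] (Fin (Module.finrank ℝ F) → ℝ) :=
    ContinuousLinearEquiv.ofFinrankEq (by simp)
  have hg : ContDiff ℝ 1 (f ∘ e.symm) := hf.comp e.symm.contDiff
  have hK' : IsCompact (e '' K) := hK.image e.continuous
  obtain ⟨C, hC⟩ := LocallyLipschitzOn.exists_lipschitzOnWith_of_compact hK'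
    hg.locallyLipschitz.locallyLipschitzOn
  have himage : f '' K = (f ∘ e.symm) '' (e '' K) := by
    simp [image_image]
  have hvol : μH[(Module.finrank ℝ F : ℝ)] (e '' K) < ⊤ := by
    have h := hausdorffMeasure_pi_real (ι := Fin (Module.finrank ℝ F))
    rw [Fintype.card_fin] at h
    rw [h]
    exact hK'.measure_lt_top
  rw [himage]
  refine (hC.hausdorffMeasure_image_le (Nat.cast_nonneg _)).trans_lt ?_
  exact ENNReal.mul_lt_top (ENNReal.rpow_lt_top_of_nonneg (Nat.cast_nonneg _) (by simp)) hvol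

lemma hausdorffMeasure_hemisphere_lt_top {E : Type*} [NormedAddCommGroup E]
    [InnerProductSpace ℝ E] [MeasurableSpace E] [BorelSpace E] {n : ℕ}
    [Fact (Module.finrank ℝ E = n + 1)] {v : E} (hv : ‖v‖ = 1) :
    μH[(n : ℝ)] (Metric.sphere (0 : E) 1 ∩ {x | inner ℝ v x ≤ 0}) < ⊤ := by
  have : FiniteDimensional ℝ E := .of_fact_finrank_eq_succ n
  have hv0 : v ≠ 0 := by
    rintro rfl
    simp at hv
  have hf : ContDiff ℝ 1 (stereoInvFunAux v ∘ ((↑) : (ℝ ∙ v)ᗮ → E)) :=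
    contDiff_stereoInvFunAux.comp (ℝ ∙ v)ᗮ.subtypeL.contDiff
  have hfin := hausdorffMeasure_image_lt_top hf (isCompact_closedBall (0 : (ℝ ∙ v)ᗮ) 2)
  rw [Submodule.finrank_orthogonal_span_singleton (n := n) hv0] at hfin
  refine (measure_mono ?_).trans_lt hfin
  rintro x ⟨hx, hxv : inner ℝ v x ≤ 0⟩
  have hxv' : x ≠ v := by
    rintro rfl
    rw [real_inner_self_eq_norm_sq, hv] at hxv
    norm_num at hxv
  refine ⟨stereoToFun v x, ?_, ?_⟩
  · rw [mem_closedBall_zero_iff, stereoToFun_apply, norm_smul, innerSL_apply_apply]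
    have h1 : ‖2 / (1 - inner ℝ v x)‖ ≤ 2 := by
      rw [Real.norm_of_nonneg (div_nonneg two_pos.le (by linarith))]
      exact div_le_self two_pos.le (by linarith)
    have h2 : ‖(ℝ ∙ v)ᗮ.orthogonalProjectionOnto x‖ ≤ 1 := by
      refine ((ℝ ∙ v)ᗮ.norm_orthogonalProjectionOnto_apply_le x).trans ?_
      rw [mem_sphere_zero_iff_norm.mp hx]
    calc _ ≤ 2 * (1 : ℝ) := mul_le_mul h1 h2 (norm_nonneg _) two_pos.le
      _ = 2 := mul_one _
  · exact congrArg Subtype.val (stereo_left_inv hv (x := ⟨x, hx⟩) hxv')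

lemma hausdorffMeasure_sphere_lt_top {E : Type*} [NormedAddCommGroup E]
    [InnerProductSpace ℝ E] [MeasurableSpace E] [BorelSpace E] {n : ℕ}
    [Fact (Module.finrank ℝ E = n + 1)] :
    μH[(n : ℝ)] (Metric.sphere (0 : E) 1) < ⊤ := by
  have : Nontrivial E := 
    Module.nontrivial_of_finrank_eq_succ (Fact.out : Module.finrank ℝ E = n + 1)
  obtain ⟨v, hv⟩ := exists_norm_eq E zero_le_one
  have hv' : ‖-v‖ = 1 := by rwa [norm_neg]
  refine (measure_mono (fun x hx => ?_)).trans_lt (measure_union_lt_top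
    (hausdorffMeasure_hemisphere_lt_top (n := n) hv)
    (hausdorffMeasure_hemisphere_lt_top (n := n) hv'))
  rcases le_total (inner ℝ v x) 0 with h | h
  · exact Or.inl ⟨hx, h⟩
  · exact Or.inr ⟨hx, by simpa [inner_neg_left] using h⟩

lemma one_div_le_cosh_div_sinh {r : ℝ} (hr : 0 < r) : 1 / r ≤ cosh r / sinh r := by
  have hs : 0 < sinh r := sinh_pos_iff.mpr hr
  have hmono : MonotoneOn (fun x : ℝ => x * cosh x - sinh x) (Ici 0) := by
    refine monotoneOn_of_hasDerivWithinAt_nonneg (f' := fun x => x * sinh x) (convex_Ici 0)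
      (by fun_prop) (fun x _ => ?_) (fun x hx => ?_)
    · have h := ((hasDerivAt_id x).mul (hasDerivAt_cosh x)).sub (hasDerivAt_sinh x)
      refine (h.congr_deriv ?_).hasDerivWithinAt
      simp
    · rw [interior_Ici] at hx
      exact mul_nonneg hx.le (sinh_pos_iff.mpr hx).le
  have h := hmono (mem_Ici.mpr le_rfl) (mem_Ici.mpr hr.le) hr.le
  rw [div_le_div_iff₀ hr hs]
  simp only [zero_mul, sinh_zero, sub_zero] at h
  linarith

lemma hasDerivAt_cosh_div_sinh {r : ℝ} (hr : 0 < r) :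
    HasDerivAt (fun x => cosh x / sinh x) (1 - (cosh r / sinh r) ^ 2) r := by
  have hs : sinh r ≠ 0 := (sinh_pos_iff.mpr hr).ne'
  refine ((hasDerivAt_cosh r).div (hasDerivAt_sinh r) hs).congr_deriv ?_
  field_simp

lemma hasDerivAt_sinh_pow (n : ℕ) {r : ℝ} (hr : 0 < r) :
    HasDerivAt (fun x => sinh x ^ n) (n * (cosh r / sinh r) * sinh r ^ n) r := by
  have hs : sinh r ≠ 0 := (sinh_pos_iff.mpr hr).ne'
  refine ((hasDerivAt_sinh r).pow n).congr_deriv ?_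
  rcases n with _ | n
  · simp
  · rw [Nat.add_sub_cancel]
    field_simp
    ring

/-- The difference of the two sides of the one-dimensional Rellich–Poincaré inequality, without the
volume density, as a function of `n = N - 1`, `c = coth r`, `r`, `v`, `v'` and `v''`. -/
def rellichIntegrand (n c r v w z : ℝ) : ℝ :=
  (z + n * c * w) ^ 2 - (n / 2) ^ 2 * w ^ 2 - (n - 3) ^ 2 / 16 * (v ^ 2 / r ^ 4)
    - n / 16 * (v ^ 2 / r ^ 2)

/-- The boundary term whose derivative is subtracted to complete squares. -/
def rellichFlux (n : ℕ) (v : ℝ → ℝ) (r : ℝ) : ℝ :=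
  ((n / 2 * (cosh r / sinh r) + 1 / 2 * r⁻¹) * deriv v r ^ 2
    - 1 / 4 * (n / 2 * (cosh r / sinh r) - 3 / 2 * r⁻¹) * r⁻¹ ^ 2 * v r ^ 2) * sinh r ^ n

/-- The derivative of the boundary term, without the volume density. -/
def rellichFluxDeriv (n c r v w z : ℝ) : ℝ :=
  (n / 2 * (1 - c ^ 2) - 1 / 2 * r⁻¹ ^ 2) * w ^ 2
    + (n / 2 * c + 1 / 2 * r⁻¹) * (2 * w * z)
    - 1 / 4 * ((n / 2 * (1 - c ^ 2) + 3 / 2 * r⁻¹ ^ 2) * r⁻¹ ^ 2 * v ^ 2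
      - (n / 2 * c - 3 / 2 * r⁻¹) * (2 * r⁻¹ ^ 3) * v ^ 2
      + (n / 2 * c - 3 / 2 * r⁻¹) * r⁻¹ ^ 2 * (2 * v * w))
    + n * c * ((n / 2 * c + 1 / 2 * r⁻¹) * w ^ 2
      - 1 / 4 * (n / 2 * c - 3 / 2 * r⁻¹) * r⁻¹ ^ 2 * v ^ 2)

lemma hasDerivAt_rellichFlux (n : ℕ) {v : ℝ → ℝ} (hv : ContDiff ℝ 2 v) {r : ℝ} (hr : 0 < r) :
    HasDerivAt (rellichFlux n v)
      (rellichFluxDeriv n (cosh r / sinh r) r (v r) (deriv v r) (deriv (deriv v) r)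
        * sinh r ^ n) r := by
  have hv1 : HasDerivAt v (deriv v r) r := (hv.differentiable (by norm_num) r).hasDerivAt
  have hv2 : HasDerivAt (deriv v) (deriv (deriv v) r) r :=
    ((hv.differentiable_deriv_two) r).hasDerivAt
  have hc := hasDerivAt_cosh_div_sinh hr
  have hi : HasDerivAt (fun x : ℝ => x⁻¹) (-(r ^ 2)⁻¹) r := hasDerivAt_inv hr.ne'
  have h := ((((hc.const_mul ((n : ℝ) / 2)).add (hi.const_mul (1 / 2))).mul (hv2.pow 2)).sub
    (((((hc.const_mul ((n : ℝ) / 2)).sub (hi.const_mul (3 / 2))).const_mul (1 / 4)).mul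
      (hi.pow 2)).mul (hv1.pow 2))).mul (hasDerivAt_sinh_pow n hr)
  refine h.congr_deriv ?_
  simp only [rellichFluxDeriv, Pi.add_apply, Pi.sub_apply, Pi.mul_apply, Pi.pow_apply]
  rw [← inv_pow]
  push_cast
  ring

lemma rellichFluxDeriv_le {n c r v w z : ℝ} (hn : 4 ≤ n) (hr : 0 < r) (hc : 1 ≤ c)
    (hcr : 1 / r ≤ c) : rellichFluxDeriv n c r v w z ≤ rellichIntegrand n c r v w z := by
  have key : rellichIntegrand n c r v w z - rellichFluxDeriv n c r v w z
      = (z + (n / 2 * c - 1 / 2 * r⁻¹) * w) ^ 2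
        + 1 / 4 * r⁻¹ ^ 2 * (w + (n / 2 * c - 3 / 2 * r⁻¹) * v) ^ 2
        + n * (n + 2) / 4 * (c ^ 2 - 1) * w ^ 2
        + n / 16 * r⁻¹ ^ 2 * ((n - 4) * (c ^ 2 - r⁻¹ ^ 2) + 2 * (c - r⁻¹) ^ 2 + 1) * v ^ 2 := by
    simp only [rellichIntegrand, rellichFluxDeriv, div_eq_mul_inv (v ^ 2),
      ← inv_pow]
    ring
  have h1 : 0 ≤ c ^ 2 - 1 := by nlinarith
  have h2 : 0 ≤ c ^ 2 - r⁻¹ ^ 2 := by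
    rw [one_div] at hcr
    exact sub_nonneg.mpr (pow_le_pow_left₀ (inv_pos.mpr hr).le hcr 2)
  have h3 : 0 ≤ n - 4 := by linarith
  have h4 : 0 ≤ n := by linarith
  rw [← sub_nonneg, key]
  positivity

lemma integral_rellichIntegrand_nonneg {n : ℕ} (hn : 4 ≤ n) {v : ℝ → ℝ} (hv : ContDiff ℝ 2 v)
    {a b : ℝ} (ha : 0 < a) (hab : a ≤ b) (hva : v a = 0) (hda : deriv v a = 0) (hvb : v b = 0)
    (hdb : deriv v b = 0) :
    0 ≤ ∫ r in a..b, rellichIntegrand n (cosh r / sinh r) r (v r) (deriv v r) (deriv (deriv v) r)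
      * sinh r ^ n := by
  have hpos : ∀ x ∈ Icc a b, 0 < x := fun x hx => ha.trans_le hx.1
  have hc0 : Continuous v := hv.continuous
  have hc1 : Continuous (deriv v) := hv.continuous_deriv (by norm_num)
  have hc2 : Continuous (deriv (deriv v)) := by
    have h : ContDiff ℝ 1 (deriv v) := hv.deriv'
    exact h.continuous_deriv le_rfl
  have h := intervalIntegral.sub_le_integral_of_hasDeriv_right_of_le hab
    (fun x hx => (hasDerivAt_rellichFlux n hv (hpos x hx)).continuousAt.continuousWithinAt)
    (fun x hx => (hasDerivAt_rellichFlux n hv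
      (hpos x (Ioo_subset_Icc_self hx))).hasDerivWithinAt)
    (φ := fun r => rellichIntegrand n (cosh r / sinh r) r (v r) (deriv v r) (deriv (deriv v) r)
      * sinh r ^ n) ?_ ?_
  · simpa [rellichFlux, hva, hda, hvb, hdb] using h
  · refine ContinuousOn.integrableOn_Icc ?_
    unfold rellichIntegrand
    fun_prop (disch := intro x hx; have := hpos x hx; have := sinh_pos_iff.mpr this; positivity)
  · intro x hx
    have hx0 := hpos x (Ioo_subset_Icc_self hx)
    have hs := sinh_pos_iff.mpr hx0
    refine mul_le_mul_of_nonneg_right (rellichFluxDeriv_le (by exact_mod_cast hn) hx0 ?_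
      (one_div_le_cosh_div_sinh hx0)) (pow_nonneg hs.le n)
    rw [one_le_div hs]
    exact (sinh_lt_cosh x).le

lemma contDiff_uncurry_radGrad {N : ℕ} {u : ℝ → EuclideanSpace ℝ (Fin N) → ℝ}
    (hu : ContDiff ℝ (⊤ : ℕ∞) (Function.uncurry u)) :
    ContDiff ℝ (⊤ : ℕ∞) (Function.uncurry (radGrad N u)) := by
  have h : Function.uncurry (radGrad N u) = fun p => fderiv ℝ (Function.uncurry u) p (1, 0) := by
    ext ⟨r, σ⟩
    have hd : HasDerivAt (fun s : ℝ => (s, σ)) ((1 : ℝ), (0 : EuclideanSpace ℝ (Fin N))) r :=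
      (hasDerivAt_id r).prodMk (hasDerivAt_const r σ)
    exact (((hu.differentiable (by simp)) (r, σ)).hasFDerivAt.comp_hasDerivAt r hd).deriv
  rw [h]
  exact (hu.fderiv_right (by simp)).clm_apply contDiff_const

lemma radGrad_eq_zero_of_notMem_Icc {N : ℕ} {u : ℝ → EuclideanSpace ℝ (Fin N) → ℝ} {a b : ℝ}
    {σ : EuclideanSpace ℝ (Fin N)} (hu : ∀ r, r ∉ Icc a b → u r σ = 0) (r : ℝ)
    (hr : r ∉ Icc a b) : radGrad N u r σ = 0 := by
  have h : (fun s => u s σ) =ᶠ[nhds r] fun _ => 0 := by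
    filter_upwards [isClosed_Icc.isOpen_compl.mem_nhds hr] with s hs using hu s hs
  exact h.deriv_eq.trans (deriv_const r 0)

lemma hypInt_eq_intervalIntegral {N : ℕ} {F : ℝ → EuclideanSpace ℝ (Fin N) → ℝ} {a b : ℝ}
    (ha : 0 < a) (hab : a ≤ b)
    (hF : ∀ σ ∈ Metric.sphere (0 : EuclideanSpace ℝ (Fin N)) 1, ∀ r, r ∉ Ioo a b → F r σ = 0) :
    hypInt N F = ∫ σ in Metric.sphere (0 : EuclideanSpace ℝ (Fin N)) 1,
      (∫ r in a..b, F r σ * sinh r ^ (N - 1)) ∂μH[(N : ℝ) - 1] := by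
  refine setIntegral_congr_fun Metric.isClosed_sphere.measurableSet fun σ hσ => ?_
  rw [intervalIntegral.integral_of_le hab]
  refine setIntegral_eq_of_subset_of_forall_sdiff_eq_zero measurableSet_Ioi
    (fun r hr => ha.trans hr.1) fun r hr => ?_
  rw [hF σ hσ r fun h => hr.2 (Ioo_subset_Ioc_self h), zero_mul]

lemma continuous_intervalIntegral_of_continuousOn {X : Type*} [TopologicalSpace X]
    [FirstCountableTopology X] [LocallyCompactSpace X] {F : ℝ → X → ℝ} {a b : ℝ} (ha : 0 < a)
    (hab : a ≤ b) (hF : ContinuousOn (Function.uncurry F) (Ioi 0 ×ˢ univ)) :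
    Continuous fun σ => ∫ r in a..b, F r σ := by
  have hmax : Continuous (Function.uncurry fun (σ : X) (r : ℝ) => F (max r a) σ) :=
    hF.comp_continuous (f := fun p : X × ℝ => (max p.2 a, p.1)) (by fun_prop)
      fun p => ⟨ha.trans_le (le_max_right _ _), mem_univ _⟩
  refine (intervalIntegral.continuous_parametric_intervalIntegral_of_continuous'
    (μ := volume) hmax a b).congr fun σ => ?_
  refine intervalIntegral.integral_congr fun r hr => ?_
  rw [uIcc_of_le hab] at hr
  simp only [max_eq_left hr.1]

lemma integrableOn_sphere_of_continuous {n : ℕ} {f : EuclideanSpace ℝ (Fin (n + 1)) → ℝ}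
    (hf : Continuous f) :
    IntegrableOn f (Metric.sphere 0 1) μH[((n + 1 : ℕ) : ℝ) - 1] := by
  have : Fact (Module.finrank ℝ (EuclideanSpace ℝ (Fin (n + 1))) = n + 1) :=
    ⟨finrank_euclideanSpace_fin⟩
  refine hf.continuousOn.integrableOn_of_subset_isCompact (isCompact_sphere 0 1)
    Metric.isClosed_sphere.measurableSet subset_rfl ?_
  rw [Nat.cast_succ, add_sub_cancel_right]
  exact hausdorffMeasure_sphere_lt_top.ne

lemma integral_sub_const_mul_three {α : Type*} [MeasurableSpace α] {μ : Measure α}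
    {f g h k : α → ℝ} (hf : Integrable f μ) (hg : Integrable g μ) (hh : Integrable h μ)
    (hk : Integrable k μ) (p q s : ℝ) :
    ∫ x, (f x - p * g x - q * h x - s * k x) ∂μ
      = ∫ x, f x ∂μ - p * ∫ x, g x ∂μ - q * ∫ x, h x ∂μ - s * ∫ x, k x ∂μ := by
  have h₁ : Integrable (fun x => f x - p * g x) μ := hf.sub (hg.const_mul p)
  have h₂ : Integrable (fun x => f x - p * g x - q * h x) μ := h₁.sub (hh.const_mul q)
  rw [integral_sub h₂ (hk.const_mul s), integral_sub h₁ (hh.const_mul q),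
    integral_sub hf (hg.const_mul p)]
  simp only [integral_const_mul]

/-- Improved radial Rellich–Poincaré inequality on `ℍ^N`, `N ≥ 5`. -/
theorem rellich_poincare_improved (N : ℕ) (hN : 5 ≤ N)
    (u : ℝ → EuclideanSpace ℝ (Fin N) → ℝ) (hu : IsCcAway N u) :
    hypInt N (fun r σ => (radLap N u r σ) ^ 2)
      - (((N : ℝ) - 1) / 2) ^ 2 * hypInt N (fun r σ => (radGrad N u r σ) ^ 2) ≥
      (((N : ℝ) - 4) ^ 2 / 16) * hypInt N (fun r σ => (u r σ) ^ 2 / r ^ 4)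
      + (((N : ℝ) - 1) / 16) * hypInt N (fun r σ => (u r σ) ^ 2 / r ^ 2) := by
  obtain ⟨hu, a, b, ha, hab, hz⟩ := hu
  obtain ⟨n, rfl⟩ : ∃ n, N = n + 1 := ⟨N - 1, by omega⟩
  have hw := contDiff_uncurry_radGrad hu
  have hz1 := fun σ hσ => radGrad_eq_zero_of_notMem_Icc fun r hr => hz r hr σ hσ
  have hz2 := fun σ hσ => radGrad_eq_zero_of_notMem_Icc (hz1 σ hσ)
  have hlap : ∀ r σ, radLap (n + 1) u r σ = radGrad (n + 1) (radGrad (n + 1) u) r σ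
      + n * (cosh r / sinh r) * radGrad (n + 1) u r σ := fun r σ => by
    simp [radLap, radGrad]
  have ha' : 0 < a / 2 := half_pos ha
  have hab' : a / 2 ≤ b + 1 := by linarith
  have hIcc : ∀ r, r ∉ Ioo (a / 2) (b + 1) → r ∉ Icc a b := fun r hr h =>
    hr ⟨by linarith [h.1], by linarith [h.2]⟩
  have hc0 := hu.continuous
  have hc1 := hw.continuous
  have hc2 := (contDiff_uncurry_radGrad hw).continuous
  have hsinh : ∀ p ∈ Ioi (0 : ℝ) ×ˢ (univ : Set (EuclideanSpace ℝ (Fin (n + 1)))),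
    sinh p.1 ≠ 0 := fun p hp => (sinh_pos_iff.mpr hp.1).ne'
  have hpow : ∀ k : ℕ, ∀ p ∈ Ioi (0 : ℝ) ×ˢ (univ : Set (EuclideanSpace ℝ (Fin (n + 1)))),
    p.1 ^ k ≠ 0 := fun k p hp => (pow_pos hp.1 k).ne'
  have hclap : ContinuousOn (Function.uncurry fun r σ => radLap (n + 1) u r σ ^ 2 * sinh r ^ n)
      (Ioi 0 ×ˢ univ) := by
    have hcoth : ContinuousOn (fun p : ℝ × EuclideanSpace ℝ (Fin (n + 1)) =>
        cosh p.1 / sinh p.1) (Ioi 0 ×ˢ univ) :=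
      ContinuousOn.div (by fun_prop) (by fun_prop) hsinh
    simp only [hlap]
    exact ((hc2.continuousOn.add ((continuousOn_const.mul hcoth).mul hc1.continuousOn)).pow 2).mul
      (by fun_prop)
  have hcgrad : ContinuousOn (Function.uncurry fun r σ => radGrad (n + 1) u r σ ^ 2 * sinh r ^ n)
      (Ioi 0 ×ˢ univ) :=
    (hc1.continuousOn.pow 2).mul (by fun_prop)
  have hcdiv : ∀ k : ℕ, ContinuousOn
      (Function.uncurry fun r σ => u r σ ^ 2 / r ^ k * sinh r ^ n) (Ioi 0 ×ˢ univ) := fun k =>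
    ((hc0.continuousOn.pow 2).div (by fun_prop) (hpow k)).mul (by fun_prop)
  rw [hypInt_eq_intervalIntegral ha' hab' fun σ hσ r hr => by
      simp [hlap, hz1 σ hσ r (hIcc r hr), hz2 σ hσ r (hIcc r hr)],
    hypInt_eq_intervalIntegral ha' hab' fun σ hσ r hr => by simp [hz1 σ hσ r (hIcc r hr)],
    hypInt_eq_intervalIntegral ha' hab' fun σ hσ r hr => by simp [hz r (hIcc r hr) σ hσ],
    hypInt_eq_intervalIntegral ha' hab' fun σ hσ r hr => by simp [hz r (hIcc r hr) σ hσ],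
    Nat.add_sub_cancel]
  have hint : ∀ {F : ℝ → EuclideanSpace ℝ (Fin (n + 1)) → ℝ},
      ContinuousOn (Function.uncurry F) (Ioi 0 ×ˢ univ) → ∀ σ,
      IntervalIntegrable (fun r => F r σ) volume (a / 2) (b + 1) := fun hF σ => by
    refine ContinuousOn.intervalIntegrable ?_
    refine hF.comp (f := fun r => (r, σ)) (by fun_prop) fun r hr => ?_
    rw [uIcc_of_le hab'] at hr
    exact ⟨ha'.trans_le hr.1, mem_univ _⟩
  have hS := fun {F : ℝ → EuclideanSpace ℝ (Fin (n + 1)) → ℝ}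
    (hF : ContinuousOn (Function.uncurry F) (Ioi 0 ×ˢ univ)) =>
      integrableOn_sphere_of_continuous
        (continuous_intervalIntegral_of_continuousOn ha' hab' hF)
  rw [ge_iff_le, ← sub_nonneg, ← sub_sub]
  rw [← integral_sub_const_mul_three (hS hclap) (hS hcgrad) (hS (hcdiv 4)) (hS (hcdiv 2))]
  refine setIntegral_nonneg Metric.isClosed_sphere.measurableSet fun σ hσ => ?_
  have hslice : ContDiff ℝ 2 fun r => u r σ :=
    (contDiff_infty.mp hu 2).comp (contDiff_id.prodMk contDiff_const)
  have hna : a / 2 ∉ Icc a b := hIcc _ fun h => lt_irrefl _ h.1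
  have hnb : b + 1 ∉ Icc a b := hIcc _ fun h => lt_irrefl _ h.2
  have h := integral_rellichIntegrand_nonneg (n := n) (by omega) hslice ha' hab'
    (hz _ hna σ hσ) (hz1 σ hσ _ hna) (hz _ hnb σ hσ) (hz1 σ hσ _ hnb)
  simp only [intervalIntegral.integral_of_le hab'] at h ⊢
  rw [← integral_sub_const_mul_three (hint hclap σ).1 (hint hcgrad σ).1 (hint (hcdiv 4) σ).1
    (hint (hcdiv 2) σ).1]
  refine h.trans_eq (integral_congr_ae (.of_forall fun r => ?_))
  simp only [rellichIntegrand, radLap, radGrad]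
  push_cast
  ring
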